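/- arXiv:1908.01200 — 10 statements merged into one kernel-verified Lean document; each statement's English description precedes it below -/
import Mathlib

section
/- Let M be any (possibly infinite-valued) matrix and let A₁,…,Aₙ be formulas none of which is a tautology of M. Then there is a finite matrix M' such that: (1) none of A₁,…,Aₙ is a tautology of M'; (2) Taut(M) ⊆ Taut(M'); and (3) the number of truth values of M' is at most ∏_{i=1}^{n} (sᵢ + 1), where sᵢ is the number of subformulas of Aᵢ. -/
/-- A propositional signature: a set of connectives with arities. -/
structure Signature where
  Conn : Type
  arity : Conn → ℕ

/-- Propositional formulas over a signature, with variables `X₀, X₁, …`. -/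
inductive Fm (S : Signature) : Type where
  | var : ℕ → Fm S
  | app : (c : S.Conn) → (Fin (S.arity c) → Fm S) → Fm S

namespace Fm

variable {S : Signature}

/-- Applying a substitution (a map from variables to formulas) to a formula. -/
def subst (σ : ℕ → Fm S) : Fm S → Fm S
  | var n => σ n
  | app c args => app c (fun i => subst σ (args i))

/-- The depth of a formula: variables and constants have depth 0. -/
def depth : Fm S → ℕ
  | var _ => 0
  | app c args =>
      if S.arity c = 0 then 0 else (Finset.univ.sup fun i => depth (args i)) + 1

/-- The (finite) set of variables occurring in a formula. -/
def fvars : Fm S → Finset ℕ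
  | var n => {n}
  | app _ args => Finset.univ.biUnion fun i => fvars (args i)

end Fm

/-- A (possibly infinite-valued) matrix for a signature: truth values,
designated values, and truth functions for the connectives. -/
structure MvMatrix (S : Signature) where
  V : Type
  desig : Set V
  interp : (c : S.Conn) → (Fin (S.arity c) → V) → V

namespace MvMatrix

variable {S : Signature}

/-- Homomorphic extension of a valuation to all formulas. -/
def eval (M : MvMatrix S) (v : ℕ → M.V) : Fm S → M.V
  | .var n => v n
  | .app c args => M.interp c fun i => M.eval v (args i)

/-- A valuation satisfies a formula if it evaluates to a designated value. -/
def Sat (M : MvMatrix S) (v : ℕ → M.V) (A : Fm S) : Prop := M.eval v A ∈ M.desig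

/-- A formula is a tautology of a matrix if every valuation satisfies it. -/
def Taut (M : MvMatrix S) (A : Fm S) : Prop := ∀ v, M.Sat v A

/-- The product of two matrices: componentwise truth functions, a pair is
designated iff both components are. -/
def prod (M M' : MvMatrix S) : MvMatrix S where
  V := M.V × M'.V
  desig := {p | p.1 ∈ M.desig ∧ p.2 ∈ M'.desig}
  interp c args := (M.interp c fun i => (args i).1, M'.interp c fun i => (args i).2)

end MvMatrix

/-- The subformula relation: `Subfm B A` means `B` is a subformula of `A`. -/
inductive Subfm {S : Signature} : Fm S → Fm S → Prop where
  | refl (A : Fm S) : Subfm A A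
  | app {B : Fm S} {c : S.Conn} {args : Fin (S.arity c) → Fm S} (i : Fin (S.arity c)) :
      Subfm B (args i) → Subfm B (Fm.app c args)

theorem finite_setOf_subfm {S : Signature} (A : Fm S) : {B | Subfm B A}.Finite := by
  induction A with
  | var n =>
    refine (Set.finite_singleton (Fm.var n)).subset fun B hB => ?_
    cases hB
    rfl
  | app c args ih =>
    refine ((Set.finite_singleton (Fm.app c args)).union (Set.finite_iUnion ih)).subset
      fun B hB => ?_
    cases hB with
    | refl => exact .inl rfl
    | app i h => exact .inr (Set.mem_iUnion.2 ⟨i, h⟩)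

namespace MvMatrix

variable {S : Signature}

/-- The product of a family of matrices, with componentwise truth functions and designation. -/
def pi {ι : Type} (N : ι → MvMatrix S) : MvMatrix S where
  V := ∀ i, (N i).V
  desig := {p | ∀ i, p i ∈ (N i).desig}
  interp c args := fun i => (N i).interp c fun j => args j i

theorem eval_pi {ι : Type} (N : ι → MvMatrix S) (v : ℕ → (pi N).V) (B : Fm S) (i : ι) :
    (pi N).eval v B i = (N i).eval (fun n => v n i) B := by
  induction B with
  | var n => rfl
  | app c args ih =>
    change (N i).interp c (fun j => (pi N).eval v (args j) i) = _
    simp only [ih, eval]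

theorem sat_pi_iff {ι : Type} (N : ι → MvMatrix S) (v : ℕ → (pi N).V) (B : Fm S) :
    (pi N).Sat v B ↔ ∀ i, (N i).Sat (fun n => v n i) B :=
  forall_congr' fun i => by rw [eval_pi, Sat]

open Classical in
/-- The restriction of a matrix to a set `U` of truth values, in which a designated value `none`
replaces every result outside `U` and propagates through all connectives. -/
noncomputable def restrict (M : MvMatrix S) (U : Set M.V) : MvMatrix S where
  V := Option U
  desig := {o | ∀ u, o = some u → u.1 ∈ M.desig}
  interp c args :=
    if h : ∃ f : Fin (S.arity c) → U, (∀ i, args i = some (f i)) ∧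
        M.interp c (fun i => (f i).1) ∈ U then
      some ⟨_, h.choose_spec.2⟩
    else none

theorem restrict_interp_eq_some (M : MvMatrix S) (U : Set M.V) (c : S.Conn)
    (args : Fin (S.arity c) → Option U) (u : U) :
    (M.restrict U).interp c args = some u ↔
      ∃ f : Fin (S.arity c) → U, (∀ i, args i = some (f i)) ∧
        M.interp c (fun i => (f i).1) = u.1 := by
  simp only [restrict]
  constructor
  · intro h
    split_ifs at h with hf
    exact ⟨hf.choose, hf.choose_spec.1, congrArg Subtype.val (Option.some.inj h)⟩
  · rintro ⟨f, hf, hu⟩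
    have h : ∃ f : Fin (S.arity c) → U, (∀ i, args i = some (f i)) ∧
        M.interp c (fun i => (f i).1) ∈ U := ⟨f, hf, hu ▸ u.2⟩
    have hfc : h.choose = f :=
      funext fun i => Option.some.inj ((h.choose_spec.1 i).symm.trans (hf i))
    rw [dif_pos h]
    exact congrArg some (Subtype.ext (by simpa only [hfc] using hu))

theorem eval_of_restrict_eval_eq_some (M : MvMatrix S) (U : Set M.V) (v : ℕ → Option U)
    (w : ℕ → M.V) (hw : ∀ n u, v n = some u → w n = u.1) (B : Fm S) (u : U)
    (h : (M.restrict U).eval v B = some u) : M.eval w B = u.1 := by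
  induction B generalizing u with
  | var n => exact hw n u h
  | app c args ih =>
    obtain ⟨f, hf, hu⟩ := (restrict_interp_eq_some M U c _ u).1 h
    simpa only [eval, ih _ _ (hf _)] using hu

theorem Taut.restrict {M : MvMatrix S} {B : Fm S} (hB : M.Taut B) (U : Set M.V) :
    (M.restrict U).Taut B := by
  intro v u hu
  have hw : ∀ n u', v n = some u' → ((v n).getD u).1 = u'.1 := by
    intro n u' h
    simp [h]
  rw [← eval_of_restrict_eval_eq_some M U v (fun n => ((v n).getD u).1) hw B u hu]
  exact hB _

open Classical in
theorem restrict_eval_eq_some (M : MvMatrix S) (U : Set M.V) (v : ℕ → M.V) (B : Fm S)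
    (hU : ∀ C, Subfm C B → M.eval v C ∈ U) :
    (M.restrict U).eval (fun n => if h : v n ∈ U then some ⟨v n, h⟩ else none) B =
      some ⟨M.eval v B, hU B (.refl B)⟩ := by
  induction B with
  | var n => exact dif_pos (hU _ (.refl _))
  | app c args ih =>
    refine (restrict_interp_eq_some M U c _ _).2
      ⟨fun i => ⟨M.eval v (args i), hU _ (.app i (.refl _))⟩, fun i => ?_, rfl⟩
    exact ih i fun C hC => hU C (.app i hC)

theorem exists_not_sat_restrict (M : MvMatrix S) (v : ℕ → M.V) (A : Fm S) (hv : ¬ M.Sat v A) :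
    ∃ w, ¬ (M.restrict (M.eval v '' {B | Subfm B A})).Sat w A := by
  classical
  refine ⟨_, fun h => hv (h _ (restrict_eval_eq_some M _ v A fun C hC => ?_))⟩
  exact Set.mem_image_of_mem _ hC

theorem card_restrict_le (M : MvMatrix S) (v : ℕ → M.V) (A : Fm S) :
    Nat.card (M.restrict (M.eval v '' {B | Subfm B A})).V ≤ {B | Subfm B A}.ncard + 1 := by
  have hfin := finite_setOf_subfm A
  have := (hfin.image (M.eval v)).to_subtype
  change Nat.card (Option (M.eval v '' {B | Subfm B A})) ≤ _
  rw [Finite.card_option, Nat.card_coe_set_eq]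
  exact Nat.add_le_add_right (Set.ncard_image_le hfin) 1

end MvMatrix

/-- If none of `A₁, …, Aₙ` is a tautology of a (possibly
infinite-valued) matrix `M`, then there is a finite matrix `M'` such that
none of the `Aᵢ` is a tautology of `M'`, `Taut(M) ⊆ Taut(M')`, and
`|V(M')| ≤ ∏ᵢ (sᵢ + 1)` where `sᵢ` is the number of subformulas of `Aᵢ`. -/
theorem finite_reduction {S : Signature} (M : MvMatrix S) (n : ℕ) (A : Fin n → Fm S)
    (hA : ∀ i, ¬ M.Taut (A i)) :
    ∃ M' : MvMatrix S, Finite M'.V ∧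
      (∀ i, ¬ M'.Taut (A i)) ∧
      (∀ B, M.Taut B → M'.Taut B) ∧
      Nat.card M'.V ≤ ∏ i, ({B | Subfm B (A i)}.ncard + 1) := by
  have hA' : ∀ i, ∃ v, ¬ M.Sat v (A i) := fun i => not_forall.1 (hA i)
  choose v hv using hA'
  let N : Fin n → MvMatrix S := fun i => M.restrict (M.eval (v i) '' {B | Subfm B (A i)})
  have hN (i : Fin n) : Finite (N i).V := by
    have := ((finite_setOf_subfm (A i)).image (M.eval (v i))).to_subtype
    exact inferInstanceAs (Finite (Option (M.eval (v i) '' {B | Subfm B (A i)})))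
  refine ⟨MvMatrix.pi N, inferInstanceAs (Finite (∀ i, (N i).V)), fun i hi => ?_,
    fun B hB w => (MvMatrix.sat_pi_iff N w B).2 fun i => hB.restrict _ _, ?_⟩
  · choose w hw using fun j => M.exists_not_sat_restrict (v j) (A j) (hv j)
    exact hw i ((MvMatrix.sat_pi_iff N (fun m j => w j m) (A i)).1 (hi _) i)
  · change Nat.card (∀ i, (N i).V) ≤ _
    rw [Nat.card_pi]
    exact Finset.prod_le_prod' fun i _ => M.card_restrict_le (v i) (A i)
end

section
/- Let C be the calculus over the language with a unary connective □ and a binary connective ◁, with sole axiom X ◁ □X and rules r₁: from X ◁ Y and Y ◁ Z infer X ◁ Z, and r₂: from X ◁ X infer Y. If C is strongly sound for a finite-valued matrix M, then every truth value of M is designated, and hence every formula is a tautology of M. -/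
/-- A rule of a Hilbert-type calculus: finitely many premises and a conclusion. -/
structure Rule (S : Signature) where
  prems : List (Fm S)
  concl : Fm S

/-- A propositional Hilbert-type calculus: finitely many axioms and rules. -/
structure Calc (S : Signature) where
  axioms : List (Fm S)
  rules : List (Rule S)

/-- Derivability in a Hilbert-type calculus: substitution instances of axioms,
closed under substitution instances of the rules. -/
inductive Deriv {S : Signature} (C : Calc S) : Fm S → Prop where
  | ax : ∀ A ∈ C.axioms, ∀ σ, Deriv C (A.subst σ)
  | rule : ∀ r ∈ C.rules, ∀ σ, (∀ A ∈ r.prems, Deriv C (A.subst σ)) →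
      Deriv C (r.concl.subst σ)

/-- `C` is strongly sound for `M`: all axioms are tautologies, and any valuation
satisfying the premises of a rule satisfies its conclusion. -/
def StronglySound {S : Signature} (C : Calc S) (M : MvMatrix S) : Prop :=
  (∀ A ∈ C.axioms, M.Taut A) ∧
  ∀ r ∈ C.rules, ∀ v, (∀ A ∈ r.prems, M.Sat v A) → M.Sat v r.concl

/-- `C` is t-sound for `M`: all axioms are tautologies, and for every rule and
substitution, if all instances of the premises are tautologies, so is the
instance of the conclusion. -/
def TSound {S : Signature} (C : Calc S) (M : MvMatrix S) : Prop :=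
  (∀ A ∈ C.axioms, M.Taut A) ∧
  ∀ r ∈ C.rules, ∀ σ, (∀ A ∈ r.prems, M.Taut (A.subst σ)) → M.Taut (r.concl.subst σ)

/-- `C` is weakly sound for `M`: every theorem of `C` is a tautology of `M`. -/
def WeaklySound {S : Signature} (C : Calc S) (M : MvMatrix S) : Prop :=
  ∀ F, Deriv C F → M.Taut F

/-- The language with a unary connective `□` and a binary connective `◁`. -/
inductive BoxLtConn : Type where
  | box
  | lt

def BoxLtSig : Signature where
  Conn := BoxLtConn
  arity := fun c => match c with | .box => 1 | .lt => 2

/-- `□A` -/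
def bx (A : Fm BoxLtSig) : Fm BoxLtSig := Fm.app BoxLtConn.box ![A]

/-- `A ◁ B` -/
def tri (A B : Fm BoxLtSig) : Fm BoxLtSig := Fm.app BoxLtConn.lt ![A, B]

/-- The calculus with sole axiom `X ◁ □X` and rules
`r₁ : X ◁ Y, Y ◁ Z / X ◁ Z` and `r₂ : X ◁ X / Y`. -/
def BoxLtCalc : Calc BoxLtSig where
  axioms := [tri (Fm.var 0) (bx (Fm.var 0))]
  rules :=
    [ ⟨[tri (Fm.var 0) (Fm.var 1), tri (Fm.var 1) (Fm.var 2)],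
        tri (Fm.var 0) (Fm.var 2)⟩,
      ⟨[tri (Fm.var 0) (Fm.var 0)], Fm.var 1⟩ ]

namespace MvMatrix

/-- The relation on truth values that holds when the value of `◁` is designated. -/
def TriRel (M : MvMatrix BoxLtSig) (x y : M.V) : Prop :=
  M.interp BoxLtConn.lt ![x, y] ∈ M.desig

/-- The truth function of `□`. -/
def boxFun (M : MvMatrix BoxLtSig) (x : M.V) : M.V :=
  M.interp BoxLtConn.box ![x]

theorem eval_bx (M : MvMatrix BoxLtSig) (v : ℕ → M.V) (A : Fm BoxLtSig) :
    M.eval v (bx A) = M.boxFun (M.eval v A) := by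
  have h : (fun i : Fin 1 => M.eval v (![A] i)) = ![M.eval v A] := by
    funext i
    fin_cases i
    rfl
  exact congrArg (M.interp BoxLtConn.box) h

theorem sat_tri (M : MvMatrix BoxLtSig) (v : ℕ → M.V) (A B : Fm BoxLtSig) :
    M.Sat v (tri A B) ↔ M.TriRel (M.eval v A) (M.eval v B) := by
  have h : (fun i : Fin 2 => M.eval v (![A, B] i)) = ![M.eval v A, M.eval v B] := by
    funext i
    fin_cases i <;> rfl
  exact iff_of_eq (congrArg (fun w => M.interp BoxLtConn.lt w ∈ M.desig) h)

end MvMatrix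

/-- A transitive relation on a finite nonempty type relating every point to its image
under some function has a reflexive point. -/
theorem exists_rel_self_of_finite {α : Type*} [Finite α] [Nonempty α] (r : α → α → Prop)
    [IsTrans α r] (f : α → α) (hf : ∀ x, r x (f x)) : ∃ x, r x x := by
  obtain ⟨a⟩ := ‹Nonempty α›
  have step (n : ℕ) : r (f^[n] a) (f^[n + 1] a) := by
    rw [Function.iterate_succ_apply']
    exact hf _
  obtain ⟨m, n, hne, heq⟩ := Finite.exists_ne_map_eq_of_infinite fun n : ℕ => f^[n] a
  rcases hne.lt_or_gt with hlt | hlt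
  · exact ⟨_, heq ▸ Nat.rel_of_forall_rel_succ_of_lt r (f := fun n => f^[n] a) step hlt⟩
  · exact ⟨_, heq ▸ Nat.rel_of_forall_rel_succ_of_lt r (f := fun n => f^[n] a) step hlt⟩

/-- If the calculus with axiom `X ◁ □X` and rules
`X ◁ Y, Y ◁ Z / X ◁ Z` and `X ◁ X / Y` is strongly sound for a finite-valued
matrix `M`, then every truth value of `M` is designated, and hence every
formula is a tautology of `M`. -/
theorem boxlt_strongly_sound_trivial (M : MvMatrix BoxLtSig) (hfin : Finite M.V)
    (hsound : StronglySound BoxLtCalc M) :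
    (∀ v : M.V, v ∈ M.desig) ∧ ∀ A : Fm BoxLtSig, M.Taut A := by
  have hdesig : ∀ y : M.V, y ∈ M.desig := by
    intro y
    obtain ⟨hax, hrule⟩ := hsound
    have : Nonempty M.V := ⟨y⟩
    have hbox (x : M.V) : M.TriRel x (M.boxFun x) := by
      have h := (M.sat_tri _ _ _).1 (hax _ List.mem_cons_self fun _ => x)
      rwa [M.eval_bx] at h
    have : IsTrans M.V M.TriRel := ⟨fun a b c hab hbc => by
      have h := hrule _ List.mem_cons_self (fun n => if n = 0 then a else if n = 1 then b else c)
      simp only [List.forall_mem_cons, M.sat_tri] at h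
      simpa [MvMatrix.eval, hab, hbc] using h⟩
    obtain ⟨x, hx⟩ := exists_rel_self_of_finite M.TriRel M.boxFun hbox
    have h := hrule _ (List.mem_cons_of_mem _ List.mem_cons_self) (fun n => if n = 0 then x else y)
    simp only [List.forall_mem_cons, M.sat_tri] at h
    simpa [MvMatrix.eval, MvMatrix.Sat, hx] using h
  exact ⟨hdesig, fun _ _ => hdesig _⟩
end

section
/- Let C be the calculus over the language with a unary connective □ and a binary connective ◁, with sole axiom X ◁ □X and rules r₁: from X ◁ Y and Y ◁ Z infer X ◁ Z, and r₂: from X ◁ X infer Y. Then the theorems of C are exactly the formulas of the form □^ℓ B ◁ □^k B with 0 ≤ ℓ < k and B an arbitrary formula. In particular, no substitution instance of X ◁ X is derivable in C, so rule r₂ is never applicable. -/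
theorem subst_bx (σ : ℕ → Fm BoxLtSig) (A : Fm BoxLtSig) :
    (bx A).subst σ = bx (A.subst σ) := by
  refine congrArg (Fm.app (S := BoxLtSig) BoxLtConn.box) (funext fun (i : Fin 1) => ?_)
  fin_cases i
  rfl

theorem subst_tri (σ : ℕ → Fm BoxLtSig) (A B : Fm BoxLtSig) :
    (tri A B).subst σ = tri (A.subst σ) (B.subst σ) := by
  refine congrArg (Fm.app (S := BoxLtSig) BoxLtConn.lt) (funext fun (i : Fin 2) => ?_)
  fin_cases i <;> rfl

theorem tri_inj {A B A' B' : Fm BoxLtSig} (h : tri A B = tri A' B') : A = A' ∧ B = B' := by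
  have h' : (![A, B] : Fin 2 → Fm BoxLtSig) = ![A', B'] := eq_of_heq (Fm.app.inj h).2
  exact ⟨congrFun h' 0, congrFun h' 1⟩

theorem depth_bx (A : Fm BoxLtSig) : (bx A).depth = A.depth + 1 := by
  change (if (1 : ℕ) = 0 then 0 else
    ((Finset.univ : Finset (Fin 1)).sup fun i => (![A] i).depth) + 1) = _
  simp

theorem depth_iterate_bx (n : ℕ) (A : Fm BoxLtSig) : (bx^[n] A).depth = A.depth + n := by
  induction n with
  | zero => rfl
  | succ n ih => rw [Function.iterate_succ_apply', depth_bx, ih, add_assoc]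

theorem iterate_bx_ne {n : ℕ} (hn : 0 < n) (A : Fm BoxLtSig) : A ≠ bx^[n] A := by
  intro h
  have := depth_iterate_bx n A
  rw [← h] at this
  omega

theorem deriv_tri_bx (A : Fm BoxLtSig) : Deriv BoxLtCalc (tri A (bx A)) := by
  have h := Deriv.ax (C := BoxLtCalc) (tri (Fm.var 0) (bx (Fm.var 0)))
    (by simp [BoxLtCalc]) (fun _ => A)
  simpa only [subst_tri, subst_bx, Fm.subst] using h

theorem deriv_tri_trans {A B D : Fm BoxLtSig} (hAB : Deriv BoxLtCalc (tri A B))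
    (hBD : Deriv BoxLtCalc (tri B D)) : Deriv BoxLtCalc (tri A D) := by
  have h := Deriv.rule (C := BoxLtCalc)
    ⟨[tri (Fm.var 0) (Fm.var 1), tri (Fm.var 1) (Fm.var 2)], tri (Fm.var 0) (Fm.var 2)⟩
    (by simp [BoxLtCalc]) (fun | 0 => A | 1 => B | _ => D)
    (by simp [subst_tri, Fm.subst, hAB, hBD])
  simpa only [subst_tri, Fm.subst] using h

theorem deriv_tri_iterate_bx (A : Fm BoxLtSig) (n : ℕ) :
    Deriv BoxLtCalc (tri A (bx^[n + 1] A)) := by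
  induction n with
  | zero => exact deriv_tri_bx A
  | succ n ih =>
    rw [Function.iterate_succ_apply']
    exact deriv_tri_trans ih (deriv_tri_bx _)

theorem Deriv.exists_eq_tri_iterate_bx {F : Fm BoxLtSig} (h : Deriv BoxLtCalc F) :
    ∃ (A : Fm BoxLtSig) (n : ℕ), 0 < n ∧ F = tri A (bx^[n] A) := by
  induction h with
  | ax A hA σ =>
    obtain rfl : A = tri (Fm.var 0) (bx (Fm.var 0)) := by simpa [BoxLtCalc] using hA
    exact ⟨σ 0, 1, one_pos, by simp [subst_tri, subst_bx, Fm.subst]⟩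
  | rule r hr σ _ ih =>
    simp only [BoxLtCalc, List.mem_cons, List.not_mem_nil, or_false] at hr
    rcases hr with rfl | rfl
    · simp only [List.mem_cons, List.not_mem_nil, or_false, forall_eq_or_imp, forall_eq,
        subst_tri, Fm.subst] at ih
      obtain ⟨⟨A, m, hm, hA⟩, B, n, -, hB⟩ := ih
      obtain ⟨rfl, hA⟩ := tri_inj hA
      obtain ⟨rfl, hB⟩ := tri_inj hB
      refine ⟨σ 0, n + m, by omega, ?_⟩
      rw [Function.iterate_add_apply, ← hA, ← hB, subst_tri]
      rfl
    · simp only [List.mem_cons, List.not_mem_nil, or_false, forall_eq,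
        subst_tri, Fm.subst] at ih
      obtain ⟨A, m, hm, hA⟩ := ih
      obtain ⟨rfl, hA⟩ := tri_inj hA
      exact absurd hA (iterate_bx_ne hm _)

/-- The theorems of the calculus with axiom `X ◁ □X` and rules
`X ◁ Y, Y ◁ Z / X ◁ Z` and `X ◁ X / Y` are exactly the formulas
`□^ℓ B ◁ □^k B` with `ℓ < k`; in particular no substitution instance
`B ◁ B` of `X ◁ X` is derivable. -/
theorem boxlt_thms (F : Fm BoxLtSig) :
    (Deriv BoxLtCalc F ↔ ∃ (B : Fm BoxLtSig) (ℓ k : ℕ), ℓ < k ∧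
      F = tri (bx^[ℓ] B) (bx^[k] B)) ∧
    ∀ B : Fm BoxLtSig, ¬ Deriv BoxLtCalc (tri B B) := by
  refine ⟨⟨fun h => ?_, ?_⟩, fun B h => ?_⟩
  · obtain ⟨A, n, hn, rfl⟩ := h.exists_eq_tri_iterate_bx
    exact ⟨A, 0, n, hn, rfl⟩
  · rintro ⟨B, l, k, hlk, rfl⟩
    obtain ⟨n, rfl⟩ := Nat.exists_eq_add_of_lt hlk
    rw [show l + n + 1 = (n + 1) + l by omega, Function.iterate_add_apply]
    exact deriv_tri_iterate_bx _ n
  · obtain ⟨A, n, hn, hA⟩ := h.exists_eq_tri_iterate_bx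
    obtain ⟨rfl, hA⟩ := tri_inj hA
    exact iterate_bx_ne hn _ hA
end

section
/- For every m ≥ 2, the (m+1)-valued Gödel logic is strictly better than the m-valued one: Taut(G_{m+1}) is a proper subset of Taut(G_m), i.e., every tautology of G_{m+1} is a tautology of G_m, but there is a tautology of G_m that is not a tautology of G_{m+1}. -/
/-- The propositional language with `¬, ∧, ∨, →`. -/
inductive IntConn : Type where
  | neg | conj | disj | imp

abbrev IntSig : Signature where
  Conn := IntConn
  arity := fun c => match c with | .neg => 1 | _ => 2

def ineg (A : Fm IntSig) : Fm IntSig := Fm.app IntConn.neg ![A]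
def iconj (A B : Fm IntSig) : Fm IntSig := Fm.app IntConn.conj ![A, B]
def idisj (A B : Fm IntSig) : Fm IntSig := Fm.app IntConn.disj ![A, B]
def iimp (A B : Fm IntSig) : Fm IntSig := Fm.app IntConn.imp ![A, B]

/-- The `m`-valued Gödel logic `G_m` (for `m ≥ 2`): truth values `{0, …, m−1}`,
sole designated value `0`, `¬v = 0` if `v = m−1` and `m−1` otherwise,
`v ∨ w = min(v,w)`, `v ∧ w = max(v,w)`, `v → w = 0` if `v ≥ w` and `w`
otherwise. -/
def Godel (m : ℕ) (hm : 2 ≤ m) : MvMatrix IntSig where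
  V := Fin m
  desig := {⟨0, by omega⟩}
  interp c args :=
    match c with
    | .neg => if (args 0).val = m - 1 then ⟨0, by omega⟩ else ⟨m - 1, by omega⟩
    | .conj => max (args 0) (args 1)
    | .disj => min (args 0) (args 1)
    | .imp => if args 1 ≤ args 0 then ⟨0, by omega⟩ else args 1

namespace Godel

/-- The embedding of `G_m` into `G_{m+1}` that skips the value `m - 1`. -/
def stretch (m : ℕ) (i : Fin m) : Fin (m + 1) :=
  if i.val = m - 1 then Fin.last m else i.castSucc

theorem val_stretch (m : ℕ) (i : Fin m) :
    (stretch m i).val = if i.val = m - 1 then m else i.val := by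
  unfold stretch
  split_ifs <;> rfl

theorem strictMono_stretch (m : ℕ) : StrictMono (stretch m) := by
  intro a b h
  rw [Fin.lt_def] at h ⊢
  rw [val_stretch, val_stretch]
  have := b.isLt
  split_ifs <;> omega

theorem interp_stretch (m : ℕ) (hm : 2 ≤ m) (hm' : 2 ≤ m + 1) (c : IntSig.Conn)
    (x : Fin (IntSig.arity c) → Fin m) :
    (Godel (m + 1) hm').interp c (fun i => stretch m (x i)) =
      stretch m ((Godel m hm).interp c x) := by
  cases c with
  | neg =>
    change Fin 1 → Fin m at x
    change (if (stretch m (x 0)).val = m + 1 - 1 then (⟨0, by omega⟩ : Fin (m + 1))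
        else ⟨m + 1 - 1, by omega⟩) =
      stretch m (if (x 0).val = m - 1 then ⟨0, by omega⟩ else ⟨m - 1, by omega⟩)
    have := (x 0).isLt
    ext
    simp only [val_stretch, apply_ite Fin.val]
    split_ifs <;> omega
  | conj =>
    change Fin 2 → Fin m at x
    exact ((strictMono_stretch m).monotone.map_max (a := x 0) (b := x 1)).symm
  | disj =>
    change Fin 2 → Fin m at x
    exact ((strictMono_stretch m).monotone.map_min (a := x 0) (b := x 1)).symm
  | imp =>
    change Fin 2 → Fin m at x
    change (if stretch m (x 1) ≤ stretch m (x 0) then (⟨0, by omega⟩ : Fin (m + 1))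
        else stretch m (x 1)) =
      stretch m (if x 1 ≤ x 0 then ⟨0, by omega⟩ else x 1)
    simp only [(strictMono_stretch m).le_iff_le]
    split_ifs
    · ext
      rw [val_stretch, if_neg (by dsimp only; omega)]
    · rfl

theorem eval_stretch (m : ℕ) (hm : 2 ≤ m) (hm' : 2 ≤ m + 1) (v : ℕ → Fin m) (A : Fm IntSig) :
    (Godel (m + 1) hm').eval (fun n => stretch m (v n)) A =
      stretch m ((Godel m hm).eval v A) := by
  induction A with
  | var n => rfl
  | app c args ih =>
    simp only [MvMatrix.eval, ih]
    exact interp_stretch m hm hm' c _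

theorem sat_iff (m : ℕ) (hm : 2 ≤ m) (v : ℕ → Fin m) (A : Fm IntSig) :
    (Godel m hm).Sat v A ↔ (Godel m hm).eval v A = (⟨0, by omega⟩ : Fin m) :=
  Iff.rfl

theorem sat_stretch_iff (m : ℕ) (hm : 2 ≤ m) (hm' : 2 ≤ m + 1) (v : ℕ → Fin m) (A : Fm IntSig) :
    (Godel (m + 1) hm').Sat (fun n => stretch m (v n)) A ↔ (Godel m hm).Sat v A := by
  rw [sat_iff, sat_iff, eval_stretch m hm hm']
  generalize (Godel m hm).eval v A = x
  change Fin m at x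
  change stretch m x = _ ↔ x = _
  rw [Fin.ext_iff, Fin.ext_iff, val_stretch]
  dsimp only
  split_ifs <;> omega

theorem sat_idisj (m : ℕ) (hm : 2 ≤ m) (v : ℕ → Fin m) (A B : Fm IntSig) :
    (Godel m hm).Sat v (idisj A B) ↔ (Godel m hm).Sat v A ∨ (Godel m hm).Sat v B := by
  rw [sat_iff, sat_iff, sat_iff]
  change @min (Fin m) _ ((Godel m hm).eval v A) ((Godel m hm).eval v B) = _ ↔ _
  generalize (Godel m hm).eval v A = x, (Godel m hm).eval v B = y
  change Fin m at x y
  change min x y = _ ↔ x = _ ∨ y = _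
  rw [Fin.ext_iff, Fin.ext_iff, Fin.ext_iff, Fin.coe_min]
  dsimp only
  omega

theorem sat_iimp_var (m : ℕ) (hm : 2 ≤ m) (v : ℕ → Fin m) (i j : ℕ) :
    (Godel m hm).Sat v (iimp (.var i) (.var j)) ↔ v j ≤ v i := by
  rw [sat_iff]
  change (if v j ≤ v i then (⟨0, by omega⟩ : Fin m) else v j) = _ ↔ _
  split_ifs with h
  · simp [h]
  · rw [Fin.ext_iff]
    rw [Fin.le_def] at h ⊢
    dsimp only
    omega

/-- The disjunction of `X_i → X_{i+1}` for `i ≤ n`. -/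
def chain : ℕ → Fm IntSig
  | 0 => iimp (.var 0) (.var 1)
  | n + 1 => idisj (chain n) (iimp (.var (n + 1)) (.var (n + 2)))

theorem sat_chain (m : ℕ) (hm : 2 ≤ m) (v : ℕ → Fin m) (n : ℕ) :
    (Godel m hm).Sat v (chain n) ↔ ∃ i ≤ n, v (i + 1) ≤ v i := by
  induction n with
  | zero => simp [chain, sat_iimp_var]
  | succ n ih =>
    rw [chain, sat_idisj, ih, sat_iimp_var]
    simp only [Nat.le_succ_iff, or_and_right, exists_or, exists_eq_left]

theorem taut_chain (m : ℕ) (hm : 2 ≤ m) : (Godel m hm).Taut (chain (m - 1)) := by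
  intro v
  change ℕ → Fin m at v
  rw [sat_chain m hm v]
  by_contra! h
  have le_val : ∀ i ≤ m, i ≤ (v i).val := by
    intro i
    induction i with
    | zero => simp
    | succ i ih =>
      intro hi
      have := ih (by omega)
      have := Fin.lt_def.mp (h i (by omega))
      omega
  have := le_val m le_rfl
  have := (v m).isLt
  omega

theorem not_taut_succ_chain (m : ℕ) (hm : 2 ≤ m) (hm' : 2 ≤ m + 1) :
    ¬ (Godel (m + 1) hm').Taut (chain (m - 1)) := by
  intro h
  obtain ⟨i, hi, hle⟩ :=
    (sat_chain (m + 1) hm' (fun i => Fin.ofNat (m + 1) i) (m - 1)).mp (h _)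
  rw [Fin.le_def, Fin.val_ofNat, Fin.val_ofNat, Nat.mod_eq_of_lt (by omega),
    Nat.mod_eq_of_lt (by omega)] at hle
  omega

end Godel

/-- For every `m ≥ 2`, `Taut(G_{m+1}) ⊊ Taut(G_m)`: every
tautology of `G_{m+1}` is a tautology of `G_m`, but some tautology of `G_m`
is not a tautology of `G_{m+1}`. -/
theorem godel_succ_strictly_better (m : ℕ) (hm : 2 ≤ m) :
    {A | (Godel (m + 1) (by omega)).Taut A} ⊂ {A | (Godel m hm).Taut A} := by
  refine Set.ssubset_iff_exists.mpr ⟨fun A hA v => ?_, Godel.chain (m - 1),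
    Godel.taut_chain m hm, Godel.not_taut_succ_chain m hm _⟩
  exact (Godel.sat_stretch_iff m hm _ v A).mp (hA _)
end

section
/- Let M₁ be an m₁-valued matrix and M₂ an m₂-valued matrix over the same propositional language, and let m = max(m₁, m₂). If there exists a formula A such that A is a tautology of M₂ but not a tautology of M₁, then there exists such a formula A* containing at most m distinct propositional variables and of depth at most m^(m^m + 1) − 1. -/
namespace MvMatrix

variable {S : Signature}

/-- The power of a matrix over an index type, with pointwise truth functions. -/
def power (M : MvMatrix S) (I : Type) : MvMatrix S where
  V := I → M.V
  desig := {f | ∀ i, f i ∈ M.desig}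
  interp c args i := M.interp c fun j => args j i

theorem eval_power (M : MvMatrix S) (I : Type) (v : ℕ → I → M.V) (A : Fm S) (i : I) :
    (M.power I).eval v A i = M.eval (fun n => v n i) A := by
  induction A with
  | var n => rfl
  | app c args ih => simp only [eval, ← ih]; rfl

theorem eval_prod (M N : MvMatrix S) (v : ℕ → M.V × N.V) (A : Fm S) :
    (M.prod N).eval v A = (M.eval (fun n => (v n).1) A, N.eval (fun n => (v n).2) A) := by
  induction A with
  | var n => rfl
  | app c args ih => simp only [eval, ih]; rfl

theorem eval_subst (M : MvMatrix S) (v : ℕ → M.V) (σ : ℕ → Fm S) (A : Fm S) :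
    M.eval v (A.subst σ) = M.eval (fun n => M.eval v (σ n)) A := by
  induction A with
  | var n => rfl
  | app c args ih => simp only [Fm.subst, eval, ih]

theorem eval_congr (M : MvMatrix S) {v w : ℕ → M.V} {A : Fm S}
    (h : ∀ n ∈ A.fvars, v n = w n) : M.eval v A = M.eval w A := by
  induction A with
  | var n => exact h n (by simp [Fm.fvars])
  | app c args ih =>
    simp only [eval]
    congr 1
    funext i
    exact ih i fun n hn => h n (Finset.mem_biUnion.mpr ⟨i, Finset.mem_univ i, hn⟩)

/-- The values, under the valuation `v`, of the formulas of depth at most `k` in the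
variables `s`. -/
def valuesOfDepth (M : MvMatrix S) (v : ℕ → M.V) (s : Finset ℕ) (k : ℕ) : Set M.V :=
  {x | ∃ A : Fm S, A.fvars ⊆ s ∧ A.depth ≤ k ∧ M.eval v A = x}

theorem valuesOfDepth_mono (M : MvMatrix S) (v : ℕ → M.V) (s : Finset ℕ) :
    Monotone (M.valuesOfDepth v s) := by
  rintro k l hkl x ⟨A, hs, hd, rfl⟩
  exact ⟨A, hs, hd.trans hkl, rfl⟩

theorem interp_mem_valuesOfDepth (M : MvMatrix S) (v : ℕ → M.V) (s : Finset ℕ) {k : ℕ}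
    (c : S.Conn) {x : Fin (S.arity c) → M.V} (h : ∀ i, x i ∈ M.valuesOfDepth v s k) :
    M.interp c x ∈ M.valuesOfDepth v s (k + 1) := by
  choose B hs hd hx using h
  refine ⟨.app c B, Finset.biUnion_subset.mpr fun i _ => hs i, ?_, ?_⟩
  · rw [Fm.depth]
    split_ifs
    · exact Nat.zero_le _
    · exact Nat.succ_le_succ (Finset.sup_le fun i _ => hd i)
  · simp only [eval, hx]

theorem eval_mem_valuesOfDepth_of_stable (M : MvMatrix S) (v : ℕ → M.V) (s : Finset ℕ) {k : ℕ}
    (h : M.valuesOfDepth v s (k + 1) = M.valuesOfDepth v s k) {A : Fm S} (hA : A.fvars ⊆ s) :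
    M.eval v A ∈ M.valuesOfDepth v s k := by
  induction A with
  | var n => exact ⟨.var n, hA, Nat.zero_le _, rfl⟩
  | app c args ih =>
    rw [← h]
    exact M.interp_mem_valuesOfDepth v s c fun i =>
      ih i (Finset.biUnion_subset.mp hA i (Finset.mem_univ i))

theorem lt_ncard_valuesOfDepth_or (M : MvMatrix S) [Finite M.V] (v : ℕ → M.V) {s : Finset ℕ}
    (hs : s.Nonempty) (k : ℕ) :
    k < (M.valuesOfDepth v s k).ncard ∨
      ∀ A : Fm S, A.fvars ⊆ s → M.eval v A ∈ M.valuesOfDepth v s k := by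
  induction k with
  | zero =>
    obtain ⟨n, hn⟩ := hs
    exact .inl ((Set.ncard_pos (Set.toFinite _)).mpr
      ⟨v n, .var n, Finset.singleton_subset_iff.mpr hn, le_rfl, rfl⟩)
  | succ k ih =>
    have hsub := M.valuesOfDepth_mono v s k.le_succ
    rcases ih with hk | hall
    · rcases hsub.eq_or_ssubset with heq | hlt
      · exact .inr fun A hA => hsub (M.eval_mem_valuesOfDepth_of_stable v s heq.symm hA)
      · exact .inl (Nat.lt_of_le_of_lt hk (Set.ncard_lt_ncard hlt (Set.toFinite _)))
    · exact .inr fun A hA => hsub (hall A hA)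

/-- In a finite matrix, every value of a formula in the variables `s` is attained by such a
formula of depth less than the number of truth values. -/
theorem exists_eval_eq_depth_le (M : MvMatrix S) [Finite M.V] (v : ℕ → M.V) {s : Finset ℕ}
    (hs : s.Nonempty) {A : Fm S} (hA : A.fvars ⊆ s) :
    ∃ B : Fm S, B.fvars ⊆ s ∧ B.depth ≤ Nat.card M.V - 1 ∧ M.eval v B = M.eval v A := by
  rcases M.lt_ncard_valuesOfDepth_or v hs (Nat.card M.V - 1) with hlt | hall
  · have huniv : M.valuesOfDepth v s (Nat.card M.V - 1) = Set.univ :=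
      Set.eq_of_subset_of_ncard_le (Set.subset_univ _)
        (by rw [Set.ncard_univ]; omega) Set.finite_univ
    exact huniv.ge (Set.mem_univ (M.eval v A))
  · exact hall A hA

end MvMatrix

theorem Fm.fvars_subst_subset {S : Signature} {σ : ℕ → Fm S} {s : Finset ℕ}
    (h : ∀ n, (σ n).fvars ⊆ s) (A : Fm S) : (A.subst σ).fvars ⊆ s := by
  induction A with
  | var n => exact h n
  | app c args ih => exact Finset.biUnion_subset.mpr fun i _ => ih i

theorem mul_pow_pow_le_max_pow {a : ℕ} (ha : 0 < a) (b : ℕ) :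
    a * b ^ b ^ a ≤ max a b ^ (max a b ^ max a b + 1) := by
  have hm : 0 < max a b := lt_max_of_lt_left ha
  rw [pow_succ']
  refine Nat.mul_le_mul (le_max_left a b) ?_
  rcases b.eq_zero_or_pos with rfl | hb
  · simpa [ha.ne'] using Nat.one_le_pow _ _ ha
  · calc b ^ b ^ a ≤ max a b ^ b ^ a := Nat.pow_le_pow_left (le_max_right a b) _
      _ ≤ max a b ^ max a b ^ max a b := by
        refine Nat.pow_le_pow_right hm ?_
        exact (Nat.pow_le_pow_left (le_max_right a b) a).trans
          (Nat.pow_le_pow_right hm (le_max_left a b))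

/-- Let `M₁` be `m₁`-valued and `M₂` be `m₂`-valued, and
`m = max(m₁, m₂)`. If some formula is a tautology of `M₂` but not of `M₁`,
then there is such a formula containing at most `m` distinct variables and
of depth at most `m^(m^m + 1) − 1`. -/
theorem small_separating_formula {S : Signature} (M₁ M₂ : MvMatrix S)
    (m₁ m₂ m : ℕ) (hfin₁ : Finite M₁.V) (hfin₂ : Finite M₂.V)
    (hm₁ : Nat.card M₁.V = m₁) (hm₂ : Nat.card M₂.V = m₂)
    (hm : m = max m₁ m₂)
    (hex : ∃ A : Fm S, M₂.Taut A ∧ ¬ M₁.Taut A) :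
    ∃ A : Fm S, M₂.Taut A ∧ ¬ M₁.Taut A ∧
      A.fvars.card ≤ m ∧ A.depth ≤ m ^ (m ^ m + 1) - 1 := by
  subst hm₁ hm₂ hm
  obtain ⟨A, hA₂, hA₁⟩ := hex
  obtain ⟨v, hv⟩ := not_forall.mp hA₁
  have : Nonempty M₁.V := ⟨v 0⟩
  have hpos : 0 < Nat.card M₁.V := Nat.card_pos
  let e : M₁.V ≃ Fin (Nat.card M₁.V) := Finite.equivFin M₁.V
  obtain ⟨g, hg⟩ : ∃ g : ℕ → M₁.V, ∀ i : Fin (Nat.card M₁.V), g i = e.symm i :=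
    ⟨fun n => if h : n < Nat.card M₁.V then e.symm ⟨n, h⟩ else v 0, fun i => by simp⟩
  let σ : ℕ → Fm S := fun n => .var (e (v n))
  have hσ : (A.subst σ).fvars ⊆ Finset.range (Nat.card M₁.V) :=
    Fm.fvars_subst_subset (fun n => by simp [σ, Fm.fvars]) A
  let N := M₁.prod (M₂.power (M₁.V → M₂.V))
  have : Finite N.V := inferInstanceAs (Finite (M₁.V × ((M₁.V → M₂.V) → M₂.V)))
  have hcard : Nat.card N.V =
      Nat.card M₁.V * Nat.card M₂.V ^ Nat.card M₂.V ^ Nat.card M₁.V := by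
    change Nat.card (M₁.V × ((M₁.V → M₂.V) → M₂.V)) = _
    rw [Nat.card_prod, Nat.card_fun, Nat.card_fun]
  obtain ⟨B, hB, hdepth, heval⟩ := N.exists_eval_eq_depth_le
    (fun n => (g n, fun w => w (g n))) (Finset.nonempty_range_iff.mpr hpos.ne') hσ
  simp only [N, MvMatrix.eval_prod] at heval
  obtain ⟨heval₁, heval₂⟩ := Prod.mk.inj heval
  refine ⟨B, fun u => ?_, fun h => hv ?_, ?_, ?_⟩
  · have hw := congrFun heval₂ fun x => u (e x)
    rw [MvMatrix.eval_power, MvMatrix.eval_power, MvMatrix.eval_subst] at hw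
    have hu : M₂.eval u B = M₂.eval (fun n => u (e (g n))) B := by
      refine M₂.eval_congr fun n hn => ?_
      have := hg ⟨n, Finset.mem_range.mp (hB hn)⟩
      simp only at this
      simp [this]
    rw [MvMatrix.Sat, hu, hw]
    exact hA₂ _
  · have hg₁ := h g
    rw [MvMatrix.Sat, heval₁, MvMatrix.eval_subst] at hg₁
    simpa [MvMatrix.Sat, σ, MvMatrix.eval, hg] using hg₁
  · exact (Finset.card_le_card hB).trans (by simp)
  · refine hdepth.trans (Nat.sub_le_sub_right ?_ 1)
    rw [hcard]
    exact mul_pow_pow_le_max_pow hpos _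
end

section
/- Every propositional logic L (set of formulas closed under substitution) is the intersection of the tautology sets of the sequence of finite matrices M_{i,i}(L): L = ⋂_{i ≥ 1} Taut(M_{i,i}(L)). -/
/-- `Frm_{i,j}`: formulas of depth `≤ i` containing only the variables
`X₀, …, X_{j-1}`. -/
def Frmij (S : Signature) (i j : ℕ) : Set (Fm S) :=
  {A | A.depth ≤ i ∧ ∀ n ∈ A.fvars, n < j}

/-- A propositional logic: a set of formulas closed under substitution. -/
def SubstClosed {S : Signature} (L : Set (Fm S)) : Prop :=
  ∀ A ∈ L, ∀ σ, A.subst σ ∈ L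

open Classical in
/-- The matrix `M_{i,j}(L)`: truth values `Frm_{i,j} ∪ {⊤}` (with `⊤ = none`),
designated values `(Frm_{i,j} ∩ L) ∪ {⊤}`, and truth functions
`□̃(F₁,…,Fₙ) = □(F₁,…,Fₙ)` if this formula is in `Frm_{i,j}`, and `⊤` otherwise. -/
noncomputable def Mij {S : Signature} (L : Set (Fm S)) (i j : ℕ) : MvMatrix S where
  V := Option {A : Fm S // A ∈ Frmij S i j}
  desig := {v | v = none ∨ ∃ A, v = some A ∧ A.val ∈ L}
  interp c args :=
    if h : ∀ k, (args k).isSome then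
      if hF : Fm.app c (fun k => ((args k).get (h k)).val) ∈ Frmij S i j then
        some ⟨Fm.app c (fun k => ((args k).get (h k)).val), hF⟩
      else none
    else none

namespace Fm

variable {S : Signature}

theorem app_arg_mem_frmij {i j : ℕ} {c : S.Conn} {args : Fin (S.arity c) → Fm S}
    (h : app c args ∈ Frmij S i j) (k : Fin (S.arity c)) : args k ∈ Frmij S i j := by
  obtain ⟨hd, hv⟩ := h
  refine ⟨?_, fun n hn => hv n ?_⟩
  · have hc : S.arity c ≠ 0 := Nat.ne_zero_of_lt k.isLt
    rw [depth, if_neg hc] at hd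
    have hk : depth (args k) ≤ Finset.univ.sup fun m => depth (args m) :=
      Finset.le_sup (f := fun m => depth (args m)) (Finset.mem_univ k)
    omega
  · rw [fvars]
    exact Finset.mem_biUnion.2 ⟨k, Finset.mem_univ k, hn⟩

theorem exists_mem_frmij (A : Fm S) : ∃ i, 1 ≤ i ∧ A ∈ Frmij S i i := by
  refine ⟨A.depth + A.fvars.sup id + 1, by omega, by omega, fun n hn => ?_⟩
  have hle : n ≤ A.fvars.sup id := Finset.le_sup (f := id) hn
  omega

end Fm

/-- The substitution induced by a valuation of `M_{i,j}(L)`; variables of value `⊤` are fixed. -/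
def Mij.substOf {S : Signature} {i j : ℕ} (v : ℕ → Option {A : Fm S // A ∈ Frmij S i j}) (n : ℕ) :
    Fm S :=
  (v n).elim (.var n) Subtype.val

/-- A formula whose value in `M_{i,j}(L)` is not `⊤` is evaluated by substitution. -/
theorem Mij.subst_eq_of_eval_eq_some {S : Signature} (L : Set (Fm S)) {i j : ℕ}
    (v : ℕ → Option {A : Fm S // A ∈ Frmij S i j}) (A : Fm S)
    (F : {A : Fm S // A ∈ Frmij S i j}) (h : (Mij L i j).eval v A = some F) :
    A.subst (substOf v) = F.val := by
  induction A generalizing F with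
  | var n =>
    have hn : v n = some F := h
    simp [Fm.subst, substOf, hn]
  | app c args ih =>
    simp only [MvMatrix.eval, Mij] at h
    split_ifs at h with hs hF
    rw [← Option.some.inj h, Fm.subst]
    congr 1
    funext k
    exact ih k _ (Option.some_get (hs k)).symm

/-- Under the valuation sending each available variable to itself, every formula of `Frm_{i,j}`
takes itself as its value. -/
theorem Mij.eval_eq_some_self {S : Signature} (L : Set (Fm S)) {i j : ℕ}
    (v : ℕ → Option {A : Fm S // A ∈ Frmij S i j})
    (hv : ∀ n (h : Fm.var n ∈ Frmij S i j), v n = some ⟨Fm.var n, h⟩)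
    (A : Fm S) (hA : A ∈ Frmij S i j) : (Mij L i j).eval v A = some ⟨A, hA⟩ := by
  induction A with
  | var n => exact hv n hA
  | app c args ih =>
    have hargs : (fun k => (Mij L i j).eval v (args k)) =
        fun k => some ⟨args k, Fm.app_arg_mem_frmij hA k⟩ :=
      funext fun k => ih k (Fm.app_arg_mem_frmij hA k)
    change (Mij L i j).interp c (fun k => (Mij L i j).eval v (args k)) = _
    rw [hargs]
    simp [Mij, hA]

/-- Every propositional logic `L` (a set of formulas closed
under substitution) is the intersection of the tautology sets of the finite
matrices `M_{i,i}(L)` for `i ≥ 1`. -/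
theorem logic_eq_iInter_mij {S : Signature} (L : Set (Fm S)) (hL : SubstClosed L) :
    L = ⋂ (i : ℕ) (_ : 1 ≤ i), {A | (Mij L i i).Taut A} := by
  classical
  ext A
  simp only [Set.mem_iInter, Set.mem_ofPred_eq]
  constructor
  · intro hA i _ v
    change (Mij L i i).eval v A = none ∨ ∃ F, (Mij L i i).eval v A = some F ∧ F.val ∈ L
    rcases h : (Mij L i i).eval v A with _ | F
    · exact Or.inl rfl
    · refine Or.inr ⟨F, rfl, ?_⟩
      rw [← Mij.subst_eq_of_eval_eq_some L v A F h]
      exact hL A hA _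
  · intro h
    obtain ⟨i, hi, hA⟩ := A.exists_mem_frmij
    let v : ℕ → Option {A : Fm S // A ∈ Frmij S i i} := fun n =>
      if hn : Fm.var n ∈ Frmij S i i then some ⟨Fm.var n, hn⟩ else none
    have hval := Mij.eval_eq_some_self L v (fun n hn => dif_pos hn) A hA
    rcases h i hi v with hnone | ⟨F, hF, hFL⟩
    · exact absurd (hval.symm.trans hnone) (Option.some_ne_none _)
    · rwa [← Option.some.inj (hval.symm.trans hF)] at hFL
end

section
/- Let C be a strictly analytic propositional Hilbert-type calculus and F a formula with C ⊬ F. Let j be such that all variables occurring in F and in the axioms and rules of C are among X₁,…,X_j. Then the finite matrix M = M_{dp(F),j}(Thm(C)) is a cover of C (C is strongly sound for M) and F is not a tautology of M. -/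
/-- A calculus is strictly analytic if for every rule with premises `Aᵢ` and
conclusion `C₀`, `Var(Aᵢ) ⊆ Var(C₀)` and `dp(Aᵢσ) ≤ dp(C₀σ)` for every
substitution `σ`. -/
def StrictlyAnalytic {S : Signature} (C : Calc S) : Prop :=
  ∀ r ∈ C.rules, ∀ A ∈ r.prems,
    A.fvars ⊆ r.concl.fvars ∧
    ∀ σ : ℕ → Fm S, (A.subst σ).depth ≤ (r.concl.subst σ).depth

/-- Derivability using only formulas from the set `G`: every formula in the
derivation (instances of axioms and of rule premises/conclusions) lies in `G`. -/
inductive DerivIn {S : Signature} (C : Calc S) (G : Set (Fm S)) : Fm S → Prop where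
  | ax : ∀ A ∈ C.axioms, ∀ σ, A.subst σ ∈ G → DerivIn C G (A.subst σ)
  | rule : ∀ r ∈ C.rules, ∀ σ, r.concl.subst σ ∈ G →
      (∀ A ∈ r.prems, DerivIn C G (A.subst σ)) → DerivIn C G (r.concl.subst σ)

namespace Fm

variable {S : Signature}

theorem depth_arg_le (c : S.Conn) (args : Fin (S.arity c) → Fm S) (k : Fin (S.arity c)) :
    (args k).depth ≤ (app c args).depth := by
  have hc : S.arity c ≠ 0 := fun h0 => (Fin.cast h0 k).elim0
  rw [depth, if_neg hc]
  exact (Finset.le_sup (f := fun i => (args i).depth) (Finset.mem_univ k)).trans (Nat.le_succ _)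

theorem fvars_arg_subset (c : S.Conn) (args : Fin (S.arity c) → Fm S) (k : Fin (S.arity c)) :
    (args k).fvars ⊆ (app c args).fvars := by
  rw [fvars]
  exact Finset.subset_biUnion_of_mem (fun i => (args i).fvars) (Finset.mem_univ k)

theorem subst_var (A : Fm S) : A.subst var = A := by
  induction A with
  | var n => rfl
  | app c args ih => simp only [subst, ih]

theorem exists_mem_fvars_of_mem_fvars_subst {σ : ℕ → Fm S} {A : Fm S} {m : ℕ}
    (hm : m ∈ (A.subst σ).fvars) : ∃ n ∈ A.fvars, m ∈ (σ n).fvars := by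
  induction A with
  | var n => exact ⟨n, by simp [fvars], hm⟩
  | app c args ih =>
    simp only [subst, fvars, Finset.mem_biUnion, Finset.mem_univ, true_and] at hm
    obtain ⟨k, hk⟩ := hm
    obtain ⟨n, hn, hmn⟩ := ih k hk
    exact ⟨n, fvars_arg_subset c args k hn, hmn⟩

end Fm

theorem Frmij.arg_mem {S : Signature} {i j : ℕ} {c : S.Conn} {args : Fin (S.arity c) → Fm S}
    (h : Fm.app c args ∈ Frmij S i j) (k : Fin (S.arity c)) : args k ∈ Frmij S i j :=
  ⟨(Fm.depth_arg_le c args k).trans h.1, fun n hn => h.2 n (Fm.fvars_arg_subset c args k hn)⟩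

namespace Mij

variable {S : Signature} {L : Set (Fm S)} {i j : ℕ}

/-- The substitution read off a valuation of `M_{i,j}(L)`; variables valued `⊤` are left fixed. -/
def toSubst (v : ℕ → Option {A : Fm S // A ∈ Frmij S i j}) (n : ℕ) : Fm S :=
  (v n).elim (.var n) Subtype.val

/-- If a formula does not evaluate to `⊤`, it evaluates to its substitution instance. -/
theorem of_eval_eq_some {v : ℕ → Option {A : Fm S // A ∈ Frmij S i j}} {A : Fm S}
    {B : {A : Fm S // A ∈ Frmij S i j}} (h : (Mij L i j).eval v A = some B) :
    B.val = A.subst (toSubst v) ∧ ∀ n ∈ A.fvars, (v n).isSome := by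
  induction A generalizing B with
  | var n =>
    change v n = some B at h
    simp [Fm.subst, Fm.fvars, toSubst, h]
  | app c args ih =>
    simp only [MvMatrix.eval, Mij] at h
    split_ifs at h with hs hF
    have key k := ih k (Option.some_get (hs k)).symm
    constructor
    · rw [← Option.some.inj h, Fm.subst]
      exact congrArg (Fm.app c) (funext fun k => (key k).1)
    · intro n hn
      simp only [Fm.fvars, Finset.mem_biUnion, Finset.mem_univ, true_and] at hn
      obtain ⟨k, hk⟩ := hn
      exact (key k).2 n hk

theorem eval_eq_some {v : ℕ → Option {A : Fm S // A ∈ Frmij S i j}} {A : Fm S}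
    (hv : ∀ n ∈ A.fvars, (v n).isSome) (hA : A.subst (toSubst v) ∈ Frmij S i j) :
    (Mij L i j).eval v A = some ⟨A.subst (toSubst v), hA⟩ := by
  induction A with
  | var n =>
    obtain ⟨B, hB⟩ := Option.isSome_iff_exists.mp (hv n (by simp [Fm.fvars]))
    change v n = _
    simp [hB, Fm.subst, toSubst]
  | app c args ih =>
    have key k := ih k (fun n hn => hv n (Fm.fvars_arg_subset c args k hn)) (Frmij.arg_mem hA k)
    change (Mij L i j).interp c (fun k => (Mij L i j).eval v (args k)) = _
    rw [funext key]
    have hA' : Fm.app c (fun k => (args k).subst (toSubst v)) ∈ Frmij S i j := hA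
    simp [Mij, hA', Fm.subst]

theorem subst_toSubst_mem {v : ℕ → Option {A : Fm S // A ∈ Frmij S i j}} {A : Fm S}
    (hv : ∀ n ∈ A.fvars, (v n).isSome) (hd : (A.subst (toSubst v)).depth ≤ i) :
    A.subst (toSubst v) ∈ Frmij S i j := by
  refine ⟨hd, fun m hm => ?_⟩
  obtain ⟨n, hn, hmn⟩ := Fm.exists_mem_fvars_of_mem_fvars_subst hm
  obtain ⟨B, hB⟩ := Option.isSome_iff_exists.mp (hv n hn)
  simp only [toSubst, hB, Option.elim_some] at hmn
  exact B.2.2 m hmn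

theorem sat_iff {v : ℕ → Option {A : Fm S // A ∈ Frmij S i j}} {A : Fm S} :
    (Mij L i j).Sat v A ↔
      ((∀ n ∈ A.fvars, (v n).isSome) → A.subst (toSubst v) ∈ Frmij S i j →
        A.subst (toSubst v) ∈ L) := by
  constructor
  · intro h hv hA
    rcases h with h | ⟨B, hB, hBL⟩
    · exact absurd ((eval_eq_some hv hA).symm.trans h) (Option.some_ne_none _)
    · exact (of_eval_eq_some hB).1 ▸ hBL
  · intro h
    rcases he : (Mij L i j).eval v A with _ | B
    · exact Or.inl he
    · obtain ⟨hB, hv⟩ := of_eval_eq_some he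
      exact Or.inr ⟨B, he, hB ▸ h hv (hB ▸ B.2)⟩

end Mij

theorem StrictlyAnalytic.stronglySound_Mij {S : Signature} {C : Calc S} (h : StrictlyAnalytic C)
    (i j : ℕ) : StronglySound C (Mij {G | Deriv C G} i j) := by
  refine ⟨fun A hA v => Mij.sat_iff.mpr fun _ _ => Deriv.ax A hA _, fun r hr v hsat => ?_⟩
  refine Mij.sat_iff.mpr fun hv hC => Deriv.rule r hr _ fun A hA => ?_
  obtain ⟨hsub, hdepth⟩ := h r hr A hA
  have hvA n (hn : n ∈ A.fvars) := hv n (hsub hn)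
  exact Mij.sat_iff.mp (hsat A hA) hvA (Mij.subst_toSubst_mem hvA ((hdepth _).trans hC.1))

theorem not_taut_Mij {S : Signature} {L : Set (Fm S)} {i j : ℕ} {F : Fm S}
    (hF : F ∈ Frmij S i j) (hL : F ∉ L) : ¬ (Mij L i j).Taut F := by
  intro ht
  let v : ℕ → Option {A : Fm S // A ∈ Frmij S i j} := fun n =>
    if hn : n < j then some ⟨.var n, by simp [Frmij, Fm.depth, Fm.fvars, hn]⟩ else none
  have hσ : Mij.toSubst v = Fm.var := by
    funext n
    by_cases hn : n < j <;> simp [Mij.toSubst, v, hn]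
  have h := Mij.sat_iff.mp (ht v)
  rw [hσ, Fm.subst_var] at h
  exact hL (h (fun n hn => by simp [v, hF.2 n hn]) hF)

/-- Let `C` be strictly analytic, `C ⊬ F`, and `j` be such that
all variables of `F` and of the axioms and rules of `C` are among
`X₀, …, X_{j−1}`. Then `M = M_{dp(F),j}(Thm(C))` is a cover of `C` (`C` is
strongly sound for `M`) and `F` is not a tautology of `M`. -/
theorem strictly_analytic_cover_falsifies {S : Signature} (C : Calc S)
    (h : StrictlyAnalytic C) (F : Fm S) (hF : ¬ Deriv C F) (j : ℕ)
    (hjF : ∀ n ∈ F.fvars, n < j)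
    (hjax : ∀ A ∈ C.axioms, ∀ n ∈ A.fvars, n < j)
    (hjrl : ∀ r ∈ C.rules, (∀ n ∈ r.concl.fvars, n < j) ∧
      ∀ A ∈ r.prems, ∀ n ∈ A.fvars, n < j) :
    StronglySound C (Mij {G | Deriv C G} F.depth j) ∧
    ¬ (Mij {G | Deriv C G} F.depth j).Taut F := by
  exact ⟨h.stronglySound_Mij _ _, not_taut_Mij ⟨le_rfl, hjF⟩ hF⟩
end

section
/- If C is a strictly analytic propositional Hilbert-type calculus, then the many-valued closure of C equals its set of theorems: a formula F is a tautology of every finite-valued cover of C if and only if C ⊢ F. -/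
namespace Fm

variable {S : Signature}

/-- The set of connectives occurring in a formula. -/
def conns : Fm S → Set S.Conn
  | var _ => ∅
  | app c args => insert c (⋃ i, conns (args i))

theorem conns_finite (A : Fm S) : A.conns.Finite := by
  induction A with
  | var n => exact Set.finite_empty
  | app c args ih => exact (Set.finite_iUnion ih).insert c

/-- A formula is over `K` and `X` if its connectives lie in `K` and its variables in `X`. -/
def Over (K : Set S.Conn) (X : Set ℕ) : Fm S → Prop
  | var n => n ∈ X
  | app c args => c ∈ K ∧ ∀ i, Over K X (args i)

theorem over_of_subset {K : Set S.Conn} {X : Set ℕ} {A : Fm S} (hK : A.conns ⊆ K)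
    (hX : ↑A.fvars ⊆ X) : A.Over K X := by
  induction A with
  | var n => exact hX (by simp [fvars])
  | app c args ih =>
    refine ⟨hK (Set.mem_insert _ _), fun i => ih i ?_ ?_⟩
    · exact fun k hk => hK (Set.mem_insert_of_mem _ (Set.mem_iUnion.2 ⟨i, hk⟩))
    · exact fun n hn => hX (Finset.mem_biUnion.2 ⟨i, Finset.mem_univ i, hn⟩)

theorem Over.subst {K : Set S.Conn} {X Y : Set ℕ} {A : Fm S} {σ : ℕ → Fm S}
    (hA : A.Over K X) (hσ : ∀ n ∈ X, (σ n).Over K Y) : (A.subst σ).Over K Y := by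
  induction A with
  | var n => exact hσ n hA
  | app c args ih => exact ⟨hA.1, fun i => ih i (hA.2 i)⟩

theorem depth_arg_lt {c : S.Conn} (args : Fin (S.arity c) → Fm S) (i : Fin (S.arity c)) :
    (args i).depth < (app c args).depth := by
  have hc : S.arity c ≠ 0 := (Nat.zero_lt_of_lt i.isLt).ne'
  rw [depth, if_neg hc]
  exact Nat.lt_succ_of_le (Finset.le_sup (f := fun i => (args i).depth) (Finset.mem_univ i))

theorem finite_over_depth_lt {K : Set S.Conn} {X : Set ℕ} (hK : K.Finite) (hX : X.Finite)
    (d : ℕ) : {A : Fm S | A.Over K X ∧ A.depth < d}.Finite := by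
  induction d with
  | zero => simp
  | succ d ih =>
    refine ((hX.image var).union (hK.biUnion fun c _ =>
      (Set.Finite.pi' fun _ : Fin (S.arity c) => ih).image (app c))).subset ?_
    rintro (n | ⟨c, args⟩) ⟨hA, hd⟩
    · exact Or.inl ⟨n, hA, rfl⟩
    · refine Or.inr (Set.mem_biUnion hA.1 ⟨args, fun i => ⟨hA.2 i, ?_⟩, rfl⟩)
      exact (depth_arg_lt args i).trans_le (Nat.lt_succ_iff.1 hd)

/-- A set of formulas closed under immediate subformulas. -/
def SubClosed (G : Set (Fm S)) : Prop :=
  ∀ c (args : Fin (S.arity c) → Fm S), app c args ∈ G → ∀ i, args i ∈ G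

end Fm

namespace MvMatrix

variable {S : Signature}

open Classical in
/-- The truncation of the term matrix to a set `G` of formulas: values outside `G` are
collapsed to an additional designated value, and a formula in `G` is designated iff it
lies in `D`. -/
noncomputable def truncated (G D : Set (Fm S)) : MvMatrix S where
  V := Option G
  desig := {x | ∀ A ∈ x, A.1 ∈ D}
  interp c args :=
    if h : ∃ f : Fin (S.arity c) → G, (∀ i, args i = some (f i)) ∧
        Fm.app c (fun i => (f i).1) ∈ G
    then some ⟨_, h.choose_spec.2⟩ else none

variable {G D : Set (Fm S)}

theorem truncated_interp_eq_some {c : S.Conn} {args : Fin (S.arity c) → Option G} {B : G} :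
    (truncated G D).interp c args = some B ↔
      ∃ f : Fin (S.arity c) → G, (∀ i, args i = some (f i)) ∧
        Fm.app c (fun i => (f i).1) = B.1 := by
  constructor
  · intro h
    simp only [truncated] at h
    split_ifs at h with hf
    exact ⟨hf.choose, hf.choose_spec.1, congrArg Subtype.val (Option.some.inj h)⟩
  · rintro ⟨f, hf, hB⟩
    have hex : ∃ f : Fin (S.arity c) → G, (∀ i, args i = some (f i)) ∧
        Fm.app c (fun i => (f i).1) ∈ G := ⟨f, hf, hB ▸ B.2⟩
    have hfe : hex.choose = f :=
      funext fun i => Option.some.inj ((hex.choose_spec.1 i).symm.trans (hf i))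
    simp only [truncated]
    rw [dif_pos hex]
    refine congrArg some (Subtype.ext ?_)
    simp only [hfe, hB]

theorem subst_eq_of_truncated_eval {v : ℕ → Option G} {σ : ℕ → Fm S}
    (hσ : ∀ n B, v n = some B → σ n = B.1) {A : Fm S} {B : G}
    (h : (truncated G D).eval v A = some B) : A.subst σ = B.1 := by
  induction A generalizing B with
  | var n => exact hσ n B h
  | app c args ih =>
    obtain ⟨f, hf, hB⟩ := truncated_interp_eq_some.1 h
    rw [← hB, Fm.subst]
    exact congrArg (Fm.app c) (funext fun i => ih i (hf i))

theorem exists_eq_some_of_truncated_eval {v : ℕ → Option G} {A : Fm S} {B : G}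
    (h : (truncated G D).eval v A = some B) : ∀ n ∈ A.fvars, ∃ g, v n = some g := by
  induction A generalizing B with
  | var m =>
    intro n hn
    rw [Fm.fvars, Finset.mem_singleton] at hn
    exact ⟨B, hn ▸ h⟩
  | app c args ih =>
    intro n hn
    obtain ⟨i, -, hi⟩ := Finset.mem_biUnion.1 hn
    obtain ⟨f, hf, -⟩ := truncated_interp_eq_some.1 h
    exact ih i (hf i) n hi

theorem truncated_eval_eq_some (hG : Fm.SubClosed G) {v : ℕ → Option G} {σ : ℕ → Fm S}
    {A : Fm S} (hσ : ∀ n ∈ A.fvars, ∃ B, v n = some B ∧ B.1 = σ n) (hA : A.subst σ ∈ G) :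
    (truncated G D).eval v A = some ⟨A.subst σ, hA⟩ := by
  induction A with
  | var n =>
    obtain ⟨B, hB, hB'⟩ := hσ n (by simp [Fm.fvars])
    exact hB.trans (congrArg some (Subtype.ext hB'))
  | app c args ih =>
    have hargs := hG c _ hA
    exact truncated_interp_eq_some.2 ⟨fun i => ⟨_, hargs i⟩, fun i => ih i
      (fun n hn => hσ n (Finset.mem_biUnion.2 ⟨i, Finset.mem_univ i, hn⟩)) (hargs i), rfl⟩

/-- If `G` contains the premises of every rule instance whose conclusion is in `G`, provided the
substitution takes values in `G` on the variables of the conclusion, then truncating to `G` gives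
a matrix for which the calculus is strongly sound. -/
theorem stronglySound_truncated {C : Calc S} (hG : Fm.SubClosed G)
    (hC : ∀ r ∈ C.rules, ∀ σ : ℕ → Fm S, r.concl.subst σ ∈ G →
      (∀ n ∈ r.concl.fvars, σ n ∈ G) → ∀ A ∈ r.prems, A.subst σ ∈ G)
    (hvars : ∀ r ∈ C.rules, ∀ A ∈ r.prems, A.fvars ⊆ r.concl.fvars) :
    StronglySound C (truncated G {A | Deriv C A}) := by
  have hσ : ∀ v : ℕ → Option G, ∃ σ : ℕ → Fm S, ∀ n B, v n = some B → σ n = B.1 := by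
    intro v
    exact ⟨fun n => (v n).elim (Fm.var n) Subtype.val, fun n B h => by simp [h]⟩
  constructor
  · intro A hA v B hB
    obtain ⟨σ, hσ⟩ := hσ v
    have := subst_eq_of_truncated_eval hσ hB
    exact this ▸ Deriv.ax A hA σ
  · intro r hr v hprem B hB
    obtain ⟨σ, hσ⟩ := hσ v
    have hconcl := subst_eq_of_truncated_eval hσ hB
    have hv := exists_eq_some_of_truncated_eval hB
    have hmem := hC r hr σ (hconcl ▸ B.2) fun n hn => by
      obtain ⟨g, hg⟩ := hv n hn
      exact hσ n g hg ▸ g.2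
    change Deriv C B.1
    refine hconcl ▸ Deriv.rule r hr σ fun A hA => ?_
    refine hprem A hA ⟨_, hmem A hA⟩ (truncated_eval_eq_some hG (fun n hn => ?_) _)
    obtain ⟨g, hg⟩ := hv n (hvars r hr A hA hn)
    exact ⟨g, hg, (hσ n g hg).symm⟩

end MvMatrix

theorem Fm.subst_var_s14 {S : Signature} (A : Fm S) : A.subst Fm.var = A := by
  induction A with
  | var n => rfl
  | app c args ih => exact congrArg (Fm.app c) (funext ih)

/-- Strong soundness implies weak soundness. -/
theorem StronglySound.weaklySound {S : Signature} {C : Calc S} {M : MvMatrix S}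
    (h : StronglySound C M) : WeaklySound C M := by
  intro F hF
  induction hF with
  | ax A hA σ =>
    intro v
    rw [MvMatrix.Sat, MvMatrix.eval_subst]
    exact h.1 A hA _
  | rule r hr σ _ ih =>
    intro v
    rw [MvMatrix.Sat, MvMatrix.eval_subst]
    refine h.2 r hr _ fun A hA => ?_
    rw [MvMatrix.Sat, ← MvMatrix.eval_subst]
    exact ih A hA v

/-- For a strictly analytic calculus `C`, the many-valued
closure equals the set of theorems: `F` is a tautology of every finite-valued
cover of `C` (every finite-valued matrix for which `C` is strongly sound) iff
`C ⊢ F`. -/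
theorem strictly_analytic_mc_eq_thm {S : Signature} (C : Calc S)
    (h : StrictlyAnalytic C) (F : Fm S) :
    (∀ M : MvMatrix S, Finite M.V → StronglySound C M → M.Taut F) ↔
    Deriv C F := by
  refine ⟨fun hF => ?_, fun hF M _ hM => hM.weaklySound F hF⟩
  let K : Set S.Conn := F.conns ∪ ⋃ r ∈ {r | r ∈ C.rules}, ⋃ A ∈ {A | A ∈ r.prems}, A.conns
  have hK : K.Finite := F.conns_finite.union <| C.rules.finite_toSet.biUnion fun r _ =>
    r.prems.finite_toSet.biUnion fun A _ => A.conns_finite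
  let G : Set (Fm S) := {A | A.Over K F.fvars ∧ A.depth < F.depth + 1}
  have hGfin : G.Finite := Fm.finite_over_depth_lt hK F.fvars.finite_toSet _
  have hG : Fm.SubClosed G := fun c args hA i =>
    ⟨hA.1.2 i, (Fm.depth_arg_lt args i).trans hA.2⟩
  have hsound : StronglySound C (MvMatrix.truncated G {A | Deriv C A}) := by
    refine MvMatrix.stronglySound_truncated hG (fun r hr σ hconcl hσ A hA => ⟨?_, ?_⟩)
      fun r hr A hA => (h r hr A hA).1
    · refine Fm.Over.subst (X := r.concl.fvars) (Fm.over_of_subset ?_ ?_) fun n hn => (hσ n hn).1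
      · exact fun k hk => Or.inr (Set.mem_biUnion hr (Set.mem_biUnion hA hk))
      · exact_mod_cast (h r hr A hA).1
    · exact ((h r hr A hA).2 σ).trans_lt hconcl.2
  have hFG : F.subst Fm.var ∈ G := by
    rw [Fm.subst_var_s14]
    exact ⟨Fm.over_of_subset Set.subset_union_left subset_rfl, Nat.lt_succ_self _⟩
  have : Finite G := hGfin
  classical
  let v : ℕ → Option G := fun n => if hn : Fm.var n ∈ G then some ⟨_, hn⟩ else none
  have hv : ∀ n ∈ F.fvars, ∃ B, v n = some B ∧ B.1 = Fm.var n := fun n hn => by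
    have hn' : Fm.var n ∈ G := ⟨hn, Nat.succ_pos _⟩
    exact ⟨⟨_, hn'⟩, dif_pos hn', rfl⟩
  have hD : Deriv C (F.subst Fm.var) := hF _ (inferInstanceAs (Finite (Option G))) hsound v
    ⟨_, hFG⟩ (MvMatrix.truncated_eval_eq_some hG hv hFG)
  rwa [Fm.subst_var_s14] at hD
end

section
/- Let K = ⟨W, R, P⟩ be a finite Kripke model and M_K the associated matrix. Then: (1) every modal formula A that is true in every Kripke model ⟨W, R, P'⟩ on the frame ⟨W, R⟩ is a tautology of M_K; and (2) if A is not true in K, then the valuation v_K does not satisfy A in M_K, so A is not a tautology of M_K. -/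
/-- The modal propositional language with `¬, ∧, ∨, →, □, ◇`. -/
inductive ModConn : Type where
  | neg | conj | disj | imp | box | dia

abbrev ModSig : Signature where
  Conn := ModConn
  arity := fun c => match c with | .neg => 1 | .box => 1 | .dia => 1 | _ => 2

/-- A Kripke model: worlds, accessibility relation, and an assignment of
sets of worlds to propositional variables. -/
structure Kripke where
  W : Type
  R : W → W → Prop
  P : ℕ → Set W

/-- Truth of a modal formula at a world of a Kripke model. -/
def Kripke.forces (K : Kripke) (α : K.W) : Fm ModSig → Prop
  | .var n => α ∈ K.P n
  | .app c args =>
    match c with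
    | .neg => ¬ K.forces α (args 0)
    | .conj => K.forces α (args 0) ∧ K.forces α (args 1)
    | .disj => K.forces α (args 0) ∨ K.forces α (args 1)
    | .imp => K.forces α (args 0) → K.forces α (args 1)
    | .box => ∀ β, K.R α β → K.forces β (args 0)
    | .dia => ∃ β, K.R α β ∧ K.forces β (args 0)

open Classical

/-- The matrix `M_K` associated with a (finite) Kripke model `K`: truth values
are the functions `W → {0,1}`, the sole designated value is the constant-1
function, the classical connectives act componentwise, and `□, ◇` are
interpreted via the accessibility relation. -/
noncomputable def MK (K : Kripke) : MvMatrix ModSig where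
  V := K.W → Bool
  desig := {w | ∀ α, w α = true}
  interp c args :=
    match c with
    | .neg => fun α => !(args 0 α)
    | .conj => fun α => args 0 α && args 1 α
    | .disj => fun α => args 0 α || args 1 α
    | .imp => fun α => !(args 0 α) || args 1 α
    | .box => fun β => decide (∀ γ, K.R β γ → args 0 γ = true)
    | .dia => fun β => decide (∃ γ, K.R β γ ∧ args 0 γ = true)

/-- The valuation `v_K` of `M_K` induced by the assignment of the Kripke
model `K`: `(v_K(X))_α = 1` iff `α ∈ P(X)`. -/
noncomputable def vK (K : Kripke) : ℕ → (K.W → Bool) :=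
  fun n α => decide (α ∈ K.P n)

/-- The value of a formula in `M_K` at a world is `1` iff the formula is true there in the model
on the frame of `K` whose assignment corresponds to the given valuation. -/
theorem MK_eval_apply_eq_true_iff (K : Kripke) (v : ℕ → K.W → Bool) (P' : ℕ → Set K.W)
    (h : ∀ n α, v n α = true ↔ α ∈ P' n) (A : Fm ModSig) (α : K.W) :
    ((MK K).eval v A : K.W → Bool) α = true ↔ Kripke.forces ⟨K.W, K.R, P'⟩ α A := by
  induction A generalizing α with
  | var n => exact h n α
  | app c args ih =>
    cases c <;> simp only [MvMatrix.eval, MK, Kripke.forces, ← ih] <;> simp [imp_iff_not_or]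

/-- For a finite Kripke model `K = ⟨W, R, P⟩` and its matrix
`M_K`: (1) every modal formula true in every Kripke model on the frame
`⟨W, R⟩` is a tautology of `M_K`; (2) if `A` is not true in `K`, then the
valuation `v_K` does not satisfy `A`, so `A` is not a tautology of `M_K`. -/
theorem MK_taut_of_frame_valid_and_falsifies (K : Kripke) (hfin : Finite K.W)
    (A : Fm ModSig) :
    ((∀ P' : ℕ → Set K.W, ∀ α : K.W, Kripke.forces ⟨K.W, K.R, P'⟩ α A) →
      (MK K).Taut A) ∧
    ((∃ α : K.W, ¬ K.forces α A) →
      ¬ (MK K).Sat (vK K) A ∧ ¬ (MK K).Taut A) := by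
  have hv := MK_eval_apply_eq_true_iff K (vK K) K.P fun n α => by simp [vK]
  have falsifies : (∃ α : K.W, ¬ K.forces α A) → ¬ (MK K).Sat (vK K) A :=
    fun ⟨α, hα⟩ hsat => hα ((hv A α).1 (hsat α))
  refine ⟨fun hA v α => ?_, fun hA => ⟨falsifies hA, fun htaut => falsifies hA (htaut _)⟩⟩
  exact (MK_eval_apply_eq_true_iff K v (fun n => {β | v n β = true})
    (fun _ _ => Iff.rfl) A α).2 (hA _ α)
end

section
/- Let K be the calculus over the language with a unary connective ○ and a binary connective ↔̃, with sole axiom X ↔̃ ○X and sole rule: from X ↔̃ Y infer X ↔̃ ○Y. For each n ≥ 2, let M_n be the matrix with truth values {0,…,n−1}, sole designated value 0, and truth functions ○̃v = v+1 if v < n−1 and n−1 otherwise, and v ↔̃ w = 0 if v < w or v = n−1, and 1 otherwise. Then: (1) every M_n is a cover of K (K is strongly sound for M_n); and (2) for every k ≥ 1 there is an n (e.g., any n ≥ k+3) such that ○^k X ↔̃ X is not a tautology of M_n. -/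
/-- The language with a unary connective `○` and a binary connective `↔̃`. -/
inductive CircConn : Type where
  | circ | iff

abbrev CircSig : Signature where
  Conn := CircConn
  arity := fun c => match c with | .circ => 1 | .iff => 2

/-- `○A` -/
def circ (A : Fm CircSig) : Fm CircSig := Fm.app CircConn.circ ![A]

/-- `A ↔̃ B` -/
def tiff (A B : Fm CircSig) : Fm CircSig := Fm.app CircConn.iff ![A, B]

/-- The calculus `K` with sole axiom `X ↔̃ ○X` and sole rule
`X ↔̃ Y / X ↔̃ ○Y`. -/
def CircCalc : Calc CircSig where
  axioms := [tiff (Fm.var 0) (circ (Fm.var 0))]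
  rules := [⟨[tiff (Fm.var 0) (Fm.var 1)], tiff (Fm.var 0) (circ (Fm.var 1))⟩]

/-- The matrix `M_n` (for `n ≥ 2`): truth values `{0,…,n−1}`, sole designated
value `0`, `○̃v = v+1` if `v < n−1` and `n−1` otherwise, and `v ↔̃ w = 0` if
`v < w` or `v = n−1`, and `1` otherwise. -/
def Mn (n : ℕ) (hn : 2 ≤ n) : MvMatrix CircSig where
  V := Fin n
  desig := {⟨0, by omega⟩}
  interp c args :=
    match c with
    | .circ =>
        if h : (args 0).val < n - 1 then ⟨(args 0).val + 1, by omega⟩ else ⟨n - 1, by omega⟩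
    | .iff =>
        if args 0 < args 1 ∨ (args 0).val = n - 1 then ⟨0, by omega⟩ else ⟨1, by omega⟩

namespace Mn

variable {n : ℕ} (hn : 2 ≤ n) (v : ℕ → (Mn n hn).V)

/-- The truth value of a formula in `Mn n hn`, as a natural number. -/
def value (A : Fm CircSig) : ℕ := Fin.val (n := n) ((Mn n hn).eval v A)

theorem value_lt (A : Fm CircSig) : value hn v A < n :=
  Fin.isLt (n := n) ((Mn n hn).eval v A)

theorem value_circ (A : Fm CircSig) :
    value hn v (circ A) = if value hn v A < n - 1 then value hn v A + 1 else n - 1 := by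
  change Fin.val (n := n) (if h : value hn v A < n - 1 then
    ⟨value hn v A + 1, by omega⟩ else ⟨n - 1, by omega⟩) = _
  split_ifs <;> rfl

theorem sat_tiff (A B : Fm CircSig) :
    (Mn n hn).Sat v (tiff A B) ↔ value hn v A < value hn v B ∨ value hn v A = n - 1 := by
  change (if value hn v A < value hn v B ∨ value hn v A = n - 1 then
    (⟨0, by omega⟩ : Fin n) else ⟨1, by omega⟩) = ⟨0, by omega⟩ ↔ _
  split_ifs with h <;> simp [h]

theorem value_circ_iterate (A : Fm CircSig) (k : ℕ) (h : value hn v A + k ≤ n - 1) :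
    value hn v (circ^[k] A) = value hn v A + k := by
  induction k with
  | zero => rfl
  | succ k ih =>
    rw [Function.iterate_succ_apply', value_circ, ih (by omega), if_pos (by omega), add_assoc]

theorem stronglySound_circCalc : StronglySound CircCalc (Mn n hn) := by
  constructor
  · intro A hA v
    obtain rfl := List.mem_singleton.mp hA
    rw [sat_tiff, value_circ]
    have := value_lt hn v (.var 0)
    split_ifs <;> omega
  · intro r hr v h
    obtain rfl := List.mem_singleton.mp hr
    have h' := h _ (List.mem_singleton.mpr rfl)
    rw [sat_tiff] at h' ⊢
    rw [value_circ]
    have := value_lt hn v (.var 0)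
    split_ifs <;> omega

theorem not_taut_tiff_circ_iterate {k : ℕ} (hk : k + 3 ≤ n) :
    ¬ (Mn n hn).Taut (tiff (circ^[k] (Fm.var 0)) (Fm.var 0)) := by
  intro h
  obtain ⟨v, hv⟩ : ∃ v : ℕ → (Mn n hn).V, value hn v (.var 0) = 0 :=
    ⟨fun _ => (⟨0, by omega⟩ : Fin n), rfl⟩
  have h' := h v
  rw [sat_tiff, value_circ_iterate _ _ _ _ (by omega), hv] at h'
  omega

end Mn

/-- (1) every `M_n` (`n ≥ 2`) is a cover of the calculus `K`
(i.e., `K` is strongly sound for `M_n`); and (2) for every `k ≥ 1` there is an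
`n` — indeed any `n ≥ k+3` — such that `○^k X ↔̃ X` is not a tautology
of `M_n`. -/
theorem circ_calc_covers :
    (∀ (n : ℕ) (hn : 2 ≤ n), StronglySound CircCalc (Mn n hn)) ∧
    (∀ k : ℕ, 1 ≤ k →
      (∃ (n : ℕ) (hn : 2 ≤ n),
        ¬ (Mn n hn).Taut (tiff (circ^[k] (Fm.var 0)) (Fm.var 0))) ∧
      (∀ (n : ℕ) (hn : 2 ≤ n), k + 3 ≤ n →
        ¬ (Mn n hn).Taut (tiff (circ^[k] (Fm.var 0)) (Fm.var 0)))) := by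
  exact ⟨fun _ hn => Mn.stronglySound_circCalc hn, fun k _ =>
    ⟨⟨k + 3, by omega, Mn.not_taut_tiff_circ_iterate _ le_rfl⟩,
      fun _ hn hk => Mn.not_taut_tiff_circ_iterate hn hk⟩⟩
end
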